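/- arXiv:1702.00057 — 2 statements merged into one kernel-verified Lean document; each statement's English description precedes it below -/
import Mathlib

section
/- The switched system ẋ = f(t,x,u,σ) is iISS w.r.t. S with iISS gain χ (i.e., forward complete w.r.t. S and there exist β ∈ KL, ρ ∈ K such that |x(t)| ≤ β(|x(t₀)|, t−t₀) + ρ(∫_{t₀}^t χ(|u(τ)|) dτ) for all t ≥ t₀ ≥ 0, all u ∈ U_m, all σ ∈ S and all x ∈ T(t₀,u,σ)) if and only if it is forward complete w.r.t. S and there exist β ∈ KL, ρ ∈ K such that |x(t)| ≤ β(|x(t₀)|, t−t₀) + ρ(∫_0^∞ χ(|u(τ)|) dτ) for all t ≥ t₀ ≥ 0, all u ∈ U_m, all σ ∈ S and all x ∈ T(t₀,u,σ). -/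
open MeasureTheory Set Filter Topology

noncomputable section

/-- A class-`K` function: continuous and strictly increasing on `[0,∞)` with `φ 0 = 0`. -/
def ClassK (φ : ℝ → ℝ) : Prop :=
  ContinuousOn φ (Set.Ici 0) ∧ StrictMonoOn φ (Set.Ici 0) ∧ φ 0 = 0

/-- A class-`K∞` function: class `K` and unbounded. -/
def ClassKInf (φ : ℝ → ℝ) : Prop :=
  ClassK φ ∧ Filter.Tendsto φ Filter.atTop Filter.atTop

/-- A class-`KL` function: `β (·, t)` is of class `K∞` for each `t ≥ 0` and `β (r, ·)`
decreases monotonically to `0` for each fixed `r ≥ 0`. -/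
def ClassKL (β : ℝ → ℝ → ℝ) : Prop :=
  (∀ t, 0 ≤ t → ClassKInf fun r => β r t) ∧
  (∀ r, 0 ≤ r → AntitoneOn (fun t => β r t) (Set.Ici 0) ∧
    Filter.Tendsto (fun t => β r t) Filter.atTop (nhds 0))

/-- A continuous positive definite function on `[0,∞)`. -/
def PosDefFun (φ : ℝ → ℝ) : Prop :=
  ContinuousOn φ (Set.Ici 0) ∧ φ 0 = 0 ∧ ∀ s, 0 < s → 0 < φ s

variable {Γ : Type*} {E : Type*} {F : Type*} {P : Type*}
  [NormedAddCommGroup E] [NormedSpace ℝ E]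
  [NormedAddCommGroup F] [NormedSpace ℝ F]
  [NormedAddCommGroup P]
  [MeasurableSpace E] [MeasurableSpace F] [MeasurableSpace P]

/-- A switching signal: piecewise constant with finitely many discontinuities on every
bounded interval of `[0,∞)`, and right-continuous. -/
def IsSwitchingSignal (σ : ℝ → Γ) : Prop :=
  ∀ b : ℝ, 0 < b → ∃ (n : ℕ) (t : ℕ → ℝ), t 0 = 0 ∧ (∀ i < n, t i < t (i + 1)) ∧ b ≤ t n ∧
    ∀ i < n, ∀ s ∈ Set.Ico (t i) (t (i + 1)), σ s = σ (t i)

/-- An admissible input: Lebesgue measurable and locally essentially bounded. -/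
def IsInput (u : ℝ → F) : Prop :=
  Measurable u ∧ ∀ b : ℝ, ∃ C : ℝ, ∀ᵐ s ∂volume, s ∈ Set.Icc (0 : ℝ) b → ‖u s‖ ≤ C

/-- A Carathéodory solution of `ẋ = f t x u σ` on the domain `D ⊆ [0,∞)` (an interval):
a continuous function satisfying the corresponding integral equation. -/
structure IsSolution (f : ℝ → E → F → Γ → E) (u : ℝ → F) (σ : ℝ → Γ)
    (D : Set ℝ) (x : ℝ → E) : Prop where
  ordConnected : D.OrdConnected
  subset_Ici : D ⊆ Set.Ici 0
  nonempty : D.Nonempty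
  continuousOn : ContinuousOn x D
  intervalIntegrable : ∀ a ∈ D, ∀ b ∈ D,
    IntervalIntegrable (fun s => f s (x s) (u s) (σ s)) volume a b
  integral_eq : ∀ a ∈ D, ∀ b ∈ D, x b = x a + ∫ s in a..b, f s (x s) (u s) (σ s)

/-- A maximally defined Carathéodory solution: one admitting no proper extension. -/
def IsMaximalSolution (f : ℝ → E → F → Γ → E) (u : ℝ → F) (σ : ℝ → Γ)
    (D : Set ℝ) (x : ℝ → E) : Prop :=
  IsSolution f u σ D x ∧
    ∀ D' : Set ℝ, ∀ x' : ℝ → E, IsSolution f u σ D' x' → D ⊆ D' → Set.EqOn x x' D → D' ⊆ D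

/-- Standing regularity assumptions on `f`: vanishing at the origin for zero input,
Lebesgue measurable in `t`, continuous in `(ξ, μ)`. -/
def Regular (f : ℝ → E → F → Γ → E) : Prop :=
  (∀ t, 0 ≤ t → ∀ i, f t 0 0 i = 0) ∧
  (∀ ξ μ i, Measurable fun t => f t ξ μ i) ∧
  (∀ t i, Continuous fun q : E × F => f t q.1 q.2 i)

/-- Forward completeness w.r.t. `S`. -/
def ForwardComplete (f : ℝ → E → F → Γ → E) (S : Set (ℝ → Γ)) : Prop :=
  ∀ t₀, 0 ≤ t₀ → ∀ u : ℝ → F, IsInput u → ∀ σ ∈ S, ∀ D x,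
    IsMaximalSolution f u σ D x → t₀ ∈ D → Set.Ici t₀ ⊆ D

/-- iISS w.r.t. `S` with iISS gain `χ`. -/
def IISS (f : ℝ → E → F → Γ → E) (S : Set (ℝ → Γ)) (χ : ℝ → ℝ) : Prop :=
  ForwardComplete f S ∧
  ∃ β ρ, ClassKL β ∧ ClassK ρ ∧
    ∀ t₀, 0 ≤ t₀ → ∀ u : ℝ → F, IsInput u → ∀ σ ∈ S, ∀ D x,
      IsMaximalSolution f u σ D x → t₀ ∈ D → ∀ t ∈ D, t₀ ≤ t →
        ‖x t‖ ≤ β ‖x t₀‖ (t - t₀) + ρ (∫ s in t₀..t, χ ‖u s‖)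

/-- 0-GUAS w.r.t. `S`. -/
def ZeroGUAS (f : ℝ → E → F → Γ → E) (S : Set (ℝ → Γ)) : Prop :=
  ∃ β, ClassKL β ∧
    ∀ t₀, 0 ≤ t₀ → ∀ σ ∈ S, ∀ D x,
      IsMaximalSolution f (fun _ => (0 : F)) σ D x → t₀ ∈ D → ∀ t ∈ D, t₀ ≤ t →
        ‖x t‖ ≤ β ‖x t₀‖ (t - t₀)

/-- UBEBS w.r.t. `S` with UBEBS gain `α`. -/
def UBEBS (f : ℝ → E → F → Γ → E) (S : Set (ℝ → Γ)) (α : ℝ → ℝ) : Prop :=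
  ∃ α₁ α₂ c, ClassK α₁ ∧ ClassK α₂ ∧ 0 ≤ c ∧
    ∀ t₀, 0 ≤ t₀ → ∀ u : ℝ → F, IsInput u → ∀ σ ∈ S, ∀ D x,
      IsMaximalSolution f u σ D x → t₀ ∈ D → ∀ t ∈ D, t₀ ≤ t →
        ‖x t‖ ≤ α₁ ‖x t₀‖ + α₂ (∫ s in t₀..t, α ‖u s‖) + c

/-- The total `χ`-energy `∫_0^∞ χ(|u(s)|) ds` of an input, as an extended nonnegative real. -/
def Energy (χ : ℝ → ℝ) (u : ℝ → F) : ENNReal :=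
  ∫⁻ s in Set.Ioi (0 : ℝ), ENNReal.ofReal (χ ‖u s‖)

/-- `χ`-BEICS w.r.t. `S`: every solution corresponding to an input of finite `χ`-energy
is defined for all future times and converges to `0`. -/
def BEICS (f : ℝ → E → F → Γ → E) (S : Set (ℝ → Γ)) (χ : ℝ → ℝ) : Prop :=
  ∀ t₀, 0 ≤ t₀ → ∀ u : ℝ → F, IsInput u → ∀ σ ∈ S, ∀ D x,
    IsMaximalSolution f u σ D x → t₀ ∈ D → Energy χ u ≠ ⊤ →
      Set.Ici t₀ ⊆ D ∧ Filter.Tendsto x Filter.atTop (nhds 0)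

/-- Condition (C1) of Assumption A, with the class-`K` function `γ`. -/
def CondC1 (f : ℝ → E → F → Γ → E) (γ : ℝ → ℝ) : Prop :=
  ∃ N : ℝ → ℝ, (∀ r, 0 ≤ r → 0 < N r) ∧ MonotoneOn N (Set.Ici 0) ∧
    ∀ t, 0 ≤ t → ∀ (ξ : E) (μ : F) (i : Γ), ‖f t ξ μ i‖ ≤ N ‖ξ‖ * (1 + γ ‖μ‖)

/-- Condition (C2) of Assumption A. -/
def CondC2 (f : ℝ → E → F → Γ → E) : Prop :=
  ∀ r, 0 < r → ∀ ε, 0 < ε → ∃ δ, 0 < δ ∧ ∀ t, 0 ≤ t → ∀ (i : Γ) (ξ : E) (μ : F),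
    ‖ξ‖ ≤ r → ‖μ‖ ≤ δ → ‖f t ξ μ i - f t ξ 0 i‖ < ε

/-- Condition (C3) of Assumption A: `f (t, ξ, 0, i)` is locally Lipschitz in `ξ`
uniformly in `t` and `i`. -/
def CondC3 (f : ℝ → E → F → Γ → E) : Prop :=
  ∀ K : Set E, IsCompact K → ∃ L, 0 ≤ L ∧ ∀ t, 0 ≤ t → ∀ (i : Γ), ∀ ξ ∈ K, ∀ ξ' ∈ K,
    ‖f t ξ 0 i - f t ξ' 0 i‖ ≤ L * ‖ξ - ξ'‖

/-- Assumption A, with `γ` the class-`K` function appearing in (C1). -/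
def AssumptionA (f : ℝ → E → F → Γ → E) (γ : ℝ → ℝ) : Prop :=
  ClassK γ ∧ CondC1 f γ ∧ CondC2 f ∧ CondC3 f

/-- Sandwich bounds `φ₁(|ξ|) ≤ V(t,ξ) ≤ φ₂(|ξ|)` with `φ₁, φ₂` of class `K∞`. -/
def StorageBounds (V : ℝ → E → ℝ) : Prop :=
  ∃ φ₁ φ₂, ClassKInf φ₁ ∧ ClassKInf φ₂ ∧
    ∀ t, 0 ≤ t → ∀ ξ : E, φ₁ ‖ξ‖ ≤ V t ξ ∧ V t ξ ≤ φ₂ ‖ξ‖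

/-- 0-OD (zero-output dissipativity) w.r.t. `S` witnessed by the storage function `V`
and the supply function `α`. -/
def ZeroODWithStorage (f : ℝ → E → F → Γ → E) (S : Set (ℝ → Γ)) (V : ℝ → E → ℝ)
    (α : ℝ → ℝ) : Prop :=
  StorageBounds V ∧
    ∀ t₀, 0 ≤ t₀ → ∀ u : ℝ → F, IsInput u → ∀ σ ∈ S, ∀ D x,
      IsMaximalSolution f u σ D x → t₀ ∈ D → ∀ t ∈ D, t₀ ≤ t →
        V t (x t) ≤ V t₀ (x t₀) + ∫ s in t₀..t, α ‖u s‖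

/-- 0-OD w.r.t. `S` with supply function `α`. -/
def ZeroOD (f : ℝ → E → F → Γ → E) (S : Set (ℝ → Γ)) (α : ℝ → ℝ) : Prop :=
  ∃ V : ℝ → E → ℝ, (∀ t ξ, 0 ≤ V t ξ) ∧ ZeroODWithStorage f S V α

/-- `h`-OD (output dissipativity) w.r.t. `S` with supply function `α`. -/
def HOD (f : ℝ → E → F → Γ → E) (h : ℝ → E → F → Γ → P) (S : Set (ℝ → Γ))
    (α : ℝ → ℝ) : Prop :=
  ∃ V : ℝ → E → ℝ, (∀ t ξ, 0 ≤ V t ξ) ∧ StorageBounds V ∧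
    ∃ α₃, PosDefFun α₃ ∧
      ∀ t₀, 0 ≤ t₀ → ∀ u : ℝ → F, IsInput u → ∀ σ ∈ S, ∀ D x,
        IsMaximalSolution f u σ D x → t₀ ∈ D → ∀ t ∈ D, t₀ ≤ t →
          V t (x t) ≤ V t₀ (x t₀) - (∫ s in t₀..t, α₃ ‖h s (x s) (u s) (σ s)‖)
            + ∫ s in t₀..t, α ‖u s‖

/-- The pair `(h, f)` is zero-input output-persistently exciting w.r.t. `S`. -/
def OutputPE (f : ℝ → E → F → Γ → E) (h : ℝ → E → F → Γ → P)
    (S : Set (ℝ → Γ)) : Prop :=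
  ∀ ε : ℝ, 0 < ε → ε ≤ 1 → ∃ T, 0 < T ∧ ∃ r, 0 < r ∧
    ∀ t₀, 0 ≤ t₀ → ∀ σ ∈ S, ∀ D x,
      IsMaximalSolution f (fun _ => (0 : F)) σ D x → t₀ ∈ D →
        ∀ t, t₀ ≤ t → Set.Icc t (t + T) ⊆ D →
          (∀ τ ∈ Set.Icc t (t + T), ε ≤ ‖x τ‖ ∧ ‖x τ‖ ≤ 1 / ε) →
            r ≤ ∫ τ in t..(t + T), ‖h τ (x τ) 0 (σ τ)‖ ^ 2

/-- Standing regularity assumptions on the output map `h`. -/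
def OutputRegular (h : ℝ → E → F → Γ → P) : Prop :=
  (∀ ξ μ i, Measurable fun t => h t ξ μ i) ∧
  (∀ t i, Continuous fun q : E × F => h t q.1 q.2 i) ∧
  ∀ K : Set E, IsCompact K → (0 : E) ∉ K → ∃ M : ℝ,
    ∀ᵐ t ∂volume, 0 ≤ t → ∀ ξ ∈ K, ∀ i : Γ, ‖h t ξ 0 i‖ ≤ M

theorem continuousOn_of_forall_Icc {X : Type*} [TopologicalSpace X] {D : Set ℝ} {x : ℝ → X}
    (h : ∀ a ∈ D, ∀ b ∈ D, ContinuousOn x (Icc a b)) : ContinuousOn x D := by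
  intro p hp
  have hsplit : D = D ∩ Iic p ∪ D ∩ Ici p := by
    rw [← inter_union_distrib_left, Iic_union_Ici, inter_univ]
  rw [hsplit]
  refine ContinuousWithinAt.union ?_ ?_
  · by_cases hq : ∃ q ∈ D, q < p
    · obtain ⟨q, hq, hqp⟩ := hq
      refine (h q hq p hp p ⟨hqp.le, le_rfl⟩).mono_of_mem_nhdsWithin ?_
      exact nhdsWithin_mono p inter_subset_right (Icc_mem_nhdsLE hqp)
    · push Not at hq
      exact continuousWithinAt_singleton.mono fun s hs => le_antisymm hs.2 (hq s hs.1)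
  · by_cases hq : ∃ q ∈ D, p < q
    · obtain ⟨q, hq, hpq⟩ := hq
      refine (h p hp q hq p ⟨le_rfl, hpq.le⟩).mono_of_mem_nhdsWithin ?_
      exact nhdsWithin_mono p inter_subset_right (Icc_mem_nhdsGE hpq)
    · push Not at hq
      exact continuousWithinAt_singleton.mono fun s hs => le_antisymm (hq s hs.1) hs.2

theorem IsSolution.congr_of_subset {Γ E F : Type*}
    [NormedAddCommGroup E] [NormedSpace ℝ E] [NormedAddCommGroup F]
    {f : ℝ → E → F → Γ → E} {u u' : ℝ → F} {σ : ℝ → Γ} {D D' : Set ℝ} {x x' : ℝ → E}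
    (h : IsSolution f u σ D x) (hD' : D'.OrdConnected) (hne : D'.Nonempty) (hsub : D' ⊆ D)
    (hu : EqOn u u' D') (hx : EqOn x x' D') : IsSolution f u' σ D' x' := by
  have hf : ∀ a ∈ D', ∀ b ∈ D', EqOn (fun s => f s (x s) (u s) (σ s))
      (fun s => f s (x' s) (u' s) (σ s)) (uIcc a b) := fun a ha b hb s hs => by
    have hs' := hD'.uIcc_subset ha hb hs
    simp only [hx hs', hu hs']
  refine ⟨hD', hsub.trans h.subset_Ici, hne, (h.continuousOn.mono hsub).congr hx.symm, ?_, ?_⟩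
  · intro a ha b hb
    exact (h.intervalIntegrable a (hsub ha) b (hsub hb)).congr
      fun s hs => hf a ha b hb (uIoc_subset_uIcc hs)
  · intro a ha b hb
    rw [← hx ha, ← hx hb, ← intervalIntegral.integral_congr (hf a ha b hb)]
    exact h.integral_eq a (hsub ha) b (hsub hb)

/-- A function that is a solution on a common interval around any two points of `D` is a
solution on `D`. -/
theorem isSolution_of_forall_pair {Γ E F : Type*}
    [NormedAddCommGroup E] [NormedSpace ℝ E] [NormedAddCommGroup F]
    {f : ℝ → E → F → Γ → E} {u : ℝ → F} {σ : ℝ → Γ} {D : Set ℝ} {x : ℝ → E}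
    (hne : D.Nonempty)
    (h : ∀ a ∈ D, ∀ b ∈ D, ∃ D' ⊆ D, a ∈ D' ∧ b ∈ D' ∧ IsSolution f u σ D' x) :
    IsSolution f u σ D x where
  ordConnected := ⟨fun a ha b hb => by
    obtain ⟨D', hsub, haD, hbD, hs⟩ := h a ha b hb
    exact (hs.ordConnected.out haD hbD).trans hsub⟩
  subset_Ici := fun a ha => by
    obtain ⟨D', -, haD, -, hs⟩ := h a ha a ha
    exact hs.subset_Ici haD
  nonempty := hne
  continuousOn := continuousOn_of_forall_Icc fun a ha b hb => by
    obtain ⟨D', -, haD, hbD, hs⟩ := h a ha b hb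
    exact hs.continuousOn.mono (hs.ordConnected.out haD hbD)
  intervalIntegrable := fun a ha b hb => by
    obtain ⟨D', -, haD, hbD, hs⟩ := h a ha b hb
    exact hs.intervalIntegrable a haD b hbD
  integral_eq := fun a ha b hb => by
    obtain ⟨D', -, haD, hbD, hs⟩ := h a ha b hb
    exact hs.integral_eq a haD b hbD

/-- Every solution extends to a maximal one. -/
theorem IsSolution.exists_isMaximalSolution {Γ E F : Type*}
    [NormedAddCommGroup E] [NormedSpace ℝ E] [NormedAddCommGroup F]
    {f : ℝ → E → F → Γ → E} {u : ℝ → F} {σ : ℝ → Γ} {D₀ : Set ℝ} {x₀ : ℝ → E}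
    (h₀ : IsSolution f u σ D₀ x₀) :
    ∃ D x, IsMaximalSolution f u σ D x ∧ D₀ ⊆ D ∧ EqOn x₀ x D₀ := by
  let Ext := {p : Set ℝ × (ℝ → E) // IsSolution f u σ p.1 p.2 ∧ D₀ ⊆ p.1 ∧ EqOn x₀ p.2 D₀}
  let r : Ext → Ext → Prop := fun p q => p.1.1 ⊆ q.1.1 ∧ EqOn p.1.2 q.1.2 p.1.1
  have hrefl : ∀ p, r p p := fun p => ⟨subset_rfl, eqOn_refl _ _⟩
  have htrans : ∀ {p q s}, r p q → r q s → r p s := fun hpq hqs =>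
    ⟨hpq.1.trans hqs.1, hpq.2.trans (hqs.2.mono hpq.1)⟩
  have hchain : ∀ c : Set Ext, IsChain r c → ∃ ub, ∀ p ∈ c, r p ub := by
    intro c hc
    rcases c.eq_empty_or_nonempty with rfl | ⟨p₀, hp₀⟩
    · exact ⟨⟨(D₀, x₀), h₀, subset_rfl, eqOn_refl _ _⟩, by simp⟩
    have hdir : ∀ p ∈ c, ∀ q ∈ c, ∃ s ∈ c, r p s ∧ r q s := by
      intro p hp q hq
      by_cases hpq : p = q
      · subst hpq
        exact ⟨p, hp, hrefl p, hrefl p⟩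
      · rcases hc hp hq hpq with h | h
        · exact ⟨q, hq, h, hrefl q⟩
        · exact ⟨p, hp, hrefl p, h⟩
    classical
    let D : Set ℝ := ⋃ p ∈ c, p.1.1
    let x : ℝ → E := fun s =>
      if h : ∃ p ∈ c, s ∈ p.1.1 then h.choose.1.2 s else 0
    have hx : ∀ p ∈ c, EqOn p.1.2 x p.1.1 := by
      intro p hp s hs
      have hex : ∃ p ∈ c, s ∈ p.1.1 := ⟨p, hp, hs⟩
      obtain ⟨q, -, hpq, hcq⟩ := hdir p hp _ hex.choose_spec.1
      simp only [x, dif_pos hex]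
      rw [hpq.2 hs, hcq.2 hex.choose_spec.2]
    have hsub : ∀ p ∈ c, p.1.1 ⊆ D := fun p hp =>
      subset_biUnion_of_mem (u := fun p : Ext => p.1.1) hp
    have hsol : IsSolution f u σ D x := by
      refine isSolution_of_forall_pair (p₀.2.1.nonempty.mono (hsub p₀ hp₀)) ?_
      intro a ha b hb
      simp only [D, mem_iUnion₂] at ha hb
      obtain ⟨p, hp, hap⟩ := ha
      obtain ⟨q, hq, hbq⟩ := hb
      obtain ⟨s, hs, hps, hqs⟩ := hdir p hp q hq
      exact ⟨s.1.1, hsub s hs, hps.1 hap, hqs.1 hbq,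
        s.2.1.congr_of_subset s.2.1.ordConnected s.2.1.nonempty subset_rfl (eqOn_refl _ _)
          (hx s hs)⟩
    exact ⟨⟨(D, x), hsol, p₀.2.2.1.trans (hsub p₀ hp₀),
      p₀.2.2.2.trans ((hx p₀ hp₀).mono p₀.2.2.1)⟩, fun p hp => ⟨hsub p hp, hx p hp⟩⟩
  obtain ⟨⟨⟨D, x⟩, hs, hD, hx⟩, hmax⟩ := exists_maximal_of_chains_bounded hchain htrans
  refine ⟨D, x, ⟨hs, fun D' x' hs' hDD' hxx' => ?_⟩, hD, hx⟩
  exact (hmax ⟨(D', x'), hs', hD.trans hDD', hx.trans (hxx'.mono hD)⟩ ⟨hDD', hxx'⟩).1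

theorem ClassK.nonneg {φ : ℝ → ℝ} (h : ClassK φ) {s : ℝ} (hs : 0 ≤ s) : 0 ≤ φ s := by
  rw [← h.2.2]
  exact h.2.1.monotoneOn self_mem_Ici hs hs

theorem ClassK.measurable_comp_norm {F : Type*} [NormedAddCommGroup F] [MeasurableSpace F]
    [OpensMeasurableSpace F] {χ : ℝ → ℝ} (hχ : ClassK χ) {u : ℝ → F} (hu : Measurable u) :
    Measurable fun s => χ ‖u s‖ := by
  have hc : Continuous fun r => χ (max r 0) :=
    hχ.1.comp_continuous (by fun_prop) fun r => le_max_right r 0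
  have := hc.measurable.comp hu.norm
  simpa [Function.comp_def] using this

theorem IsInput.integrableOn_comp_norm {F : Type*} [NormedAddCommGroup F] [MeasurableSpace F]
    [OpensMeasurableSpace F] {χ : ℝ → ℝ} (hχ : ClassK χ) {u : ℝ → F} (hu : IsInput u)
    {a b : ℝ} (ha : 0 ≤ a) : IntegrableOn (fun s => χ ‖u s‖) (Ioc a b) := by
  obtain ⟨C, hC⟩ := hu.2 b
  refine Measure.integrableOn_of_bounded (M := χ (max C 0)) measure_Ioc_lt_top.ne
    (hχ.measurable_comp_norm hu.1).aestronglyMeasurable ?_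
  rw [ae_restrict_iff' measurableSet_Ioc]
  filter_upwards [hC] with s hs hmem
  rw [Real.norm_of_nonneg (hχ.nonneg (norm_nonneg _))]
  exact hχ.2.1.monotoneOn (norm_nonneg (u s)) (le_max_right C 0)
    ((hs ⟨ha.trans hmem.1.le, hmem.2⟩).trans (le_max_left C 0))

theorem IsInput.indicator {F : Type*} [NormedAddCommGroup F] [MeasurableSpace F]
    {u : ℝ → F} (hu : IsInput u) {A : Set ℝ} (hA : MeasurableSet A) :
    IsInput (A.indicator u) := by
  refine ⟨hu.1.indicator hA, fun b => ?_⟩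
  obtain ⟨C, hC⟩ := hu.2 b
  refine ⟨C, ?_⟩
  filter_upwards [hC] with s hs hmem
  exact (norm_indicator_le_norm_self u s).trans (hs hmem)

theorem energy_indicator_Icc {F : Type*} [NormedAddCommGroup F] {χ : ℝ → ℝ} (h0 : χ 0 = 0)
    (u : ℝ → F) {a b : ℝ} (ha : 0 ≤ a) :
    Energy χ ((Icc a b).indicator u) = ∫⁻ s in Ioc a b, ENNReal.ofReal (χ ‖u s‖) := by
  have hind : (fun s => ENNReal.ofReal (χ ‖(Icc a b).indicator u s‖)) =
      (Icc a b).indicator fun s => ENNReal.ofReal (χ ‖u s‖) := by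
    funext s
    by_cases hs : s ∈ Icc a b <;> simp [hs, h0]
  rw [Energy, hind, lintegral_indicator measurableSet_Icc, Measure.restrict_restrict
    measurableSet_Icc]
  refine setLIntegral_congr ?_
  have h : (Icc a b ∩ Ioi 0 : Set ℝ) =ᵐ[volume] (Icc a b ∩ Ici 0 : Set ℝ) :=
    (ae_eq_refl _).inter Ioi_ae_eq_Ici
  rw [inter_eq_left.2 (Icc_subset_Ici_self.trans (Ici_subset_Ici.2 ha))] at h
  exact h.trans Ioc_ae_eq_Icc.symm

/-- Remark `iiss-norm`: iISS w.r.t. `S` with gain `χ` is equivalent to the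
variant of the definition in which the input energy `∫_{t₀}^t χ(|u(τ)|) dτ` is replaced by the
total energy `‖u‖_χ = ∫_0^∞ χ(|u(τ)|) dτ`. -/
theorem stmt2 {n m : ℕ} {Γ : Type*} [Nonempty Γ]
    (f : ℝ → EuclideanSpace ℝ (Fin n) → EuclideanSpace ℝ (Fin m) → Γ → EuclideanSpace ℝ (Fin n))
    (hreg : Regular f)
    (S : Set (ℝ → Γ)) (hS : ∀ σ ∈ S, IsSwitchingSignal σ)
    (χ : ℝ → ℝ) (hχ : ClassK χ) :
    IISS f S χ ↔
      (ForwardComplete f S ∧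
        ∃ β ρ, ClassKL β ∧ ClassK ρ ∧
          ∀ t₀, 0 ≤ t₀ → ∀ u, IsInput u → Energy χ u ≠ ⊤ → ∀ σ ∈ S, ∀ D x,
            IsMaximalSolution f u σ D x → t₀ ∈ D → ∀ t ∈ D, t₀ ≤ t →
              ‖x t‖ ≤ β ‖x t₀‖ (t - t₀) + ρ (Energy χ u).toReal) := by
  constructor
  · rintro ⟨hfc, β, ρ, hβ, hρ, hest⟩
    refine ⟨hfc, β, ρ, hβ, hρ, fun t₀ ht₀ u hu hE σ hσ D x hx ht₀D t htD htt => ?_⟩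
    refine (hest t₀ ht₀ u hu σ hσ D x hx ht₀D t htD htt).trans ?_
    have hnn : ∀ s, 0 ≤ χ ‖u s‖ := fun s => hχ.nonneg (norm_nonneg _)
    have hle : ∫ s in t₀..t, χ ‖u s‖ ≤ (Energy χ u).toReal := by
      rw [intervalIntegral.integral_of_le htt, integral_eq_lintegral_of_nonneg_ae
        (Eventually.of_forall hnn) (hχ.measurable_comp_norm hu.1).aestronglyMeasurable]
      exact ENNReal.toReal_mono hE
        (lintegral_mono_set fun s hs => ht₀.trans_lt hs.1)
    have := hρ.2.1.monotoneOn (intervalIntegral.integral_nonneg htt fun s _ => hnn s)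
      ENNReal.toReal_nonneg hle
    linarith
  · rintro ⟨hfc, β, ρ, hβ, hρ, hest⟩
    refine ⟨hfc, β, ρ, hβ, hρ, fun t₀ ht₀ u hu σ hσ D x hx ht₀D t htD htt => ?_⟩
    have hsol : IsSolution f ((Icc t₀ t).indicator u) σ (Icc t₀ t) x :=
      hx.1.congr_of_subset ordConnected_Icc (nonempty_Icc.2 htt)
        (hx.1.ordConnected.out ht₀D htD) (fun s hs => (indicator_of_mem hs u).symm)
        (eqOn_refl _ _)
    obtain ⟨D', x', hx', hsub, heq⟩ := hsol.exists_isMaximalSolution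
    have hl : t₀ ∈ Icc t₀ t := left_mem_Icc.2 htt
    have hr : t ∈ Icc t₀ t := right_mem_Icc.2 htt
    have hint := hu.integrableOn_comp_norm hχ (b := t) ht₀
    have hnn : ∀ s, 0 ≤ χ ‖u s‖ := fun s => hχ.nonneg (norm_nonneg _)
    have hE := energy_indicator_Icc hχ.2.2 u (b := t) ht₀
    have hfin : Energy χ ((Icc t₀ t).indicator u) ≠ ⊤ := by
      rw [hE]
      exact hint.lintegral_lt_top.ne
    have hreal : ∫ s in t₀..t, χ ‖u s‖ = (Energy χ ((Icc t₀ t).indicator u)).toReal := by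
      rw [hE, intervalIntegral.integral_of_le htt, integral_eq_lintegral_of_nonneg_ae
        (Eventually.of_forall hnn) hint.aestronglyMeasurable]
    rw [hreal, heq hl, heq hr]
    exact hest t₀ ht₀ _ (hu.indicator measurableSet_Icc) hfin σ hσ D' x' hx' (hsub hl) t
      (hsub hr) htt
end
end

section
/- Suppose the switched system ẋ = f(t,x,u,σ) is iISS w.r.t. S with iISS gain χ. Then the system is χ-BEICS w.r.t. S, i.e., every solution x ∈ T(t₀,u,σ) with t₀ ≥ 0, σ ∈ S and input u ∈ U_m satisfying ∫_0^∞ χ(|u(τ)|) dτ < ∞ satisfies x(t) → 0 as t → ∞. -/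
open MeasureTheory Set Filter Topology

noncomputable section

variable {Γ : Type*} {E : Type*} {F : Type*} {P : Type*}
  [NormedAddCommGroup E] [NormedSpace ℝ E]
  [NormedAddCommGroup F] [NormedSpace ℝ F]
  [NormedAddCommGroup P]
  [MeasurableSpace E] [MeasurableSpace F] [MeasurableSpace P]

/-- A class-`K` function composed with the norm is continuous. -/
lemma ClassK.continuous_comp_norm {G : Type*} [SeminormedAddCommGroup G] {φ : ℝ → ℝ}
    (hφ : ClassK φ) : Continuous fun v : G => φ ‖v‖ :=
  hφ.1.comp_continuous continuous_norm fun v => norm_nonneg v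

lemma ClassK.nonneg_s4 {φ : ℝ → ℝ} (hφ : ClassK φ) {r : ℝ} (hr : 0 ≤ r) : 0 ≤ φ r := by
  have h := hφ.2.1.monotoneOn self_mem_Ici hr hr
  rwa [hφ.2.2] at h

/-- A class-`K` function is small near `0`. -/
lemma ClassK.exists_lt {φ : ℝ → ℝ} (hφ : ClassK φ) {ε : ℝ} (hε : 0 < ε) :
    ∃ δ, 0 < δ ∧ ∀ r, 0 ≤ r → r < δ → φ r < ε := by
  obtain ⟨δ, hδ, h⟩ := Metric.continuousOn_iff.1 hφ.1 0 self_mem_Ici ε hε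
  refine ⟨δ, hδ, fun r hr hrδ => ?_⟩
  have h' := h r hr (by rwa [Real.dist_eq, sub_zero, abs_of_nonneg hr])
  rw [hφ.2.2, Real.dist_eq, sub_zero] at h'
  exact (le_abs_self _).trans_lt h'

/-- A measurable input of finite `χ`-energy has integrable `χ`-power. -/
lemma integrableOn_of_energy_ne_top {G : Type*} [NormedAddCommGroup G] [MeasurableSpace G]
    [BorelSpace G] {χ : ℝ → ℝ} (hχ : ClassK χ) {u : ℝ → G} (hu : Measurable u)
    (hE : Energy χ u ≠ ⊤) : IntegrableOn (fun s => χ ‖u s‖) (Ioi 0) := by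
  have hmeas : Measurable fun s => χ ‖u s‖ :=
    (hχ.continuous_comp_norm (G := G)).measurable.comp hu
  exact (lintegral_ofReal_ne_top_iff_integrable hmeas.aestronglyMeasurable
    (ae_of_all _ fun s => hχ.nonneg_s4 (norm_nonneg _))).1 hE

/-- The integrals of an integrable function over late intervals are small. -/
lemma exists_abs_intervalIntegral_lt {g : ℝ → ℝ} (hg : IntegrableOn g (Ioi 0)) {δ : ℝ}
    (hδ : 0 < δ) : ∃ N, ∀ a b, 0 ≤ a → N ≤ a → a ≤ b → |∫ s in a..b, g s| < δ := by
  have hlim := intervalIntegral_tendsto_integral_Ioi 0 hg tendsto_id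
  obtain ⟨N, hN⟩ := Metric.cauchySeq_iff.1 hlim.cauchySeq δ hδ
  have hint : ∀ t, 0 ≤ t → IntervalIntegrable g volume 0 t := fun t ht =>
    (intervalIntegrable_iff_integrableOn_Ioc_of_le ht).2 (hg.mono_set Ioc_subset_Ioi_self)
  refine ⟨N, fun a b ha hNa hab => ?_⟩
  rw [← intervalIntegral.integral_interval_sub_left (hint b (ha.trans hab)) (hint a ha)]
  exact hN b (hNa.trans hab) a hNa

/-- Proposition `iISSimpliesBEICS`: iISS w.r.t. `S` with iISS gain `χ`
implies the `χ`-BEICS property w.r.t. `S`. -/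
theorem stmt4 {n m : ℕ} {Γ : Type*} [Nonempty Γ]
    (f : ℝ → EuclideanSpace ℝ (Fin n) → EuclideanSpace ℝ (Fin m) → Γ → EuclideanSpace ℝ (Fin n))
    (hreg : Regular f)
    (S : Set (ℝ → Γ)) (hS : ∀ σ ∈ S, IsSwitchingSignal σ)
    (χ : ℝ → ℝ) (hχ : ClassK χ)
    (hiISS : IISS f S χ) :
    BEICS f S χ := by
  obtain ⟨hfc, β, ρ, hβ, hρ, hbound⟩ := hiISS
  intro t₀ ht₀ u hu σ hσ D x hx ht₀D hE
  have hD : Ici t₀ ⊆ D := hfc t₀ ht₀ u hu σ hσ D x hx ht₀D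
  refine ⟨hD, ?_⟩
  rw [Metric.tendsto_atTop]
  intro ε hε
  obtain ⟨δ, hδ, hρδ⟩ := hρ.exists_lt (half_pos hε)
  obtain ⟨N, hN⟩ := exists_abs_intervalIntegral_lt
    (integrableOn_of_energy_ne_top hχ hu.1 hE) hδ
  set t₁ := max t₀ N
  have ht₁ : 0 ≤ t₁ := ht₀.trans (le_max_left _ _)
  have ht₁D : t₁ ∈ D := hD (le_max_left t₀ N)
  have hβlim : Tendsto (fun t => β ‖x t₁‖ (t - t₁)) atTop (𝓝 0) :=
    (hβ.2 ‖x t₁‖ (norm_nonneg _)).2.comp (tendsto_atTop_add_const_right _ (-t₁) tendsto_id)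
  obtain ⟨M, hM⟩ := eventually_atTop.1 (hβlim.eventually_lt_const (half_pos hε))
  refine ⟨max t₁ M, fun t ht => ?_⟩
  have htt₁ : t₁ ≤ t := (le_max_left _ _).trans ht
  have hest := hbound t₁ ht₁ u hu σ hσ D x hx ht₁D t
    (hD ((le_max_left t₀ N).trans htt₁)) htt₁
  have hsmall := hρδ (∫ s in t₁..t, χ ‖u s‖)
    (intervalIntegral.integral_nonneg htt₁ fun s _ => hχ.nonneg_s4 (norm_nonneg _))
    ((le_abs_self _).trans_lt (hN t₁ t ht₁ (le_max_right _ _) htt₁))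
  have hdecay := hM t ((le_max_right _ _).trans ht)
  rw [dist_zero_right]
  linarith
end
end
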